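/- arXiv:2510.13021 — 2 statements merged into one kernel-verified Lean document; each statement's English description precedes it below -/
import Mathlib

section
/- Translation invariance of the primal energy under self-equilibrated boundary loads: if Σ_{b ∈ Eb} ℓb b • g b = 0 in EuclideanSpace ℝ (Fin 2), then for every displacement u : Fin N → EuclideanSpace ℝ (Fin 2) and every constant vector w ∈ EuclideanSpace ℝ (Fin 2), the displacement u' defined by u' i = u i + w satisfies E(u') = E(u), and moreover u' ∈ K if and only if u ∈ K. -/
open scoped RealInnerProductSpace

/-- Translation invariance of the primal energy under self-equilibrated boundary
loads: adding a constant vector `w` to the displacement leaves the energy unchanged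
and preserves feasibility. -/
theorem primal_translation_invariance
    {N : ℕ} (hN : 1 ≤ N)
    {Ei Eb : Type*} [Fintype Ei] [Fintype Eb]
    (cp cm : Ei → Fin N) (ℓ : Ei → ℝ) (hℓ : ∀ e, 0 < ℓ e)
    (n t : Ei → EuclideanSpace ℝ (Fin 2))
    (c : Eb → Fin N) (ℓb : Eb → ℝ) (hℓb : ∀ b, 0 < ℓb b)
    (g : Eb → EuclideanSpace ℝ (Fin 2))
    (s_T : ℝ) (hs : 0 < s_T)
    (E : (Fin N → EuclideanSpace ℝ (Fin 2)) → ℝ)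
    (hE : ∀ u, E u =
      ∑ e : Ei, s_T * ℓ e * |⟪u (cp e) - u (cm e), t e⟫|
        - ∑ b : Eb, ℓb b * ⟪g b, u (c b)⟫)
    (K : Set (Fin N → EuclideanSpace ℝ (Fin 2)))
    (hK : K = {u | ∀ e : Ei, 0 ≤ ⟪u (cp e) - u (cm e), n e⟫})
    (hbal : ∑ b : Eb, ℓb b • g b = (0 : EuclideanSpace ℝ (Fin 2)))
    (u : Fin N → EuclideanSpace ℝ (Fin 2))
    (w : EuclideanSpace ℝ (Fin 2)) :
    E (fun i => u i + w) = E u ∧ ((fun i => u i + w) ∈ K ↔ u ∈ K) := by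
  have hload : ∑ b : Eb, ℓb b * ⟪g b, w⟫ = 0 := by
    simpa [sum_inner, real_inner_smul_left] using congrArg (fun v => ⟪v, w⟫) hbal
  refine ⟨?_, by simp [hK]⟩
  simp [hE, inner_add_right, mul_add, Finset.sum_add_distrib, hload]
end

section
/- Divergence control of curl-free compactly supported fields: let c ⊂ ℝ² be an open set and C > 0 a constant such that the Poincaré inequality holds on c, i.e. ‖ψ‖_{L²(ℝ²)} ≤ C · (∫_{ℝ²} ((∂₁ψ)² + (∂₂ψ)²))^{1/2} for every smooth real-valued function ψ with compact support contained in c. Then every smooth vector field φ = (φ₁, φ₂) : ℝ² → ℝ² with compact support contained in c and with ∂₁φ₂ − ∂₂φ₁ = 0 everywhere satisfies ‖φ‖_{L²} ≤ C · ‖∂₁φ₁ + ∂₂φ₂‖_{L²}, i.e. ∫_{ℝ²} (φ₁² + φ₂²) ≤ C² · ∫_{ℝ²} (∂₁φ₁ + ∂₂φ₂)². -/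
open MeasureTheory

section IntegrationByParts

variable {E : Type*} [NormedAddCommGroup E] [NormedSpace ℝ E]

/-- A directional derivative of a smooth function is smooth. -/
theorem ContDiff.fderiv_apply_const_top {f : E → ℝ} (hf : ContDiff ℝ (⊤ : ℕ∞) f) (v : E) :
    ContDiff ℝ (⊤ : ℕ∞) (fun x => fderiv ℝ f x v) :=
  (hf.fderiv_right (m := (⊤ : ℕ∞)) (by simp)).clm_apply contDiff_const

/-- Directional derivatives of a smooth function commute. -/
theorem ContDiff.fderiv_fderiv_apply_comm {f : E → ℝ} (hf : ContDiff ℝ (⊤ : ℕ∞) f) (v w x : E) :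
    fderiv ℝ (fun y => fderiv ℝ f y v) x w = fderiv ℝ (fun y => fderiv ℝ f y w) x v := by
  have hd : DifferentiableAt ℝ (fderiv ℝ f) x :=
    ((hf.fderiv_right (m := (⊤ : ℕ∞)) (by simp)).differentiable (by simp)) x
  have hsymm : IsSymmSndFDerivAt ℝ f x :=
    hf.contDiffAt.isSymmSndFDerivAt
      (by rw [minSmoothness_of_isRCLikeNormedField]; exact WithTop.coe_le_coe.mpr le_top)
  rw [fderiv_clm_apply hd (differentiableAt_const v),
    fderiv_clm_apply hd (differentiableAt_const w)]
  simpa using hsymm w v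

variable [MeasurableSpace E] [BorelSpace E] {μ : Measure E}

/-- A product of two smooth functions, the first compactly supported, is integrable. -/
theorem ContDiff.integrable_mul_of_hasCompactSupport [IsFiniteMeasureOnCompacts μ] {f g : E → ℝ}
    (hf : ContDiff ℝ (⊤ : ℕ∞) f) (hg : ContDiff ℝ (⊤ : ℕ∞) g) (hfs : HasCompactSupport f) :
    Integrable (fun x => f x * g x) μ :=
  (hf.continuous.mul hg.continuous).integrable_of_hasCompactSupport hfs.mul_right

/-- The directions of differentiation may be exchanged in `∫ ∂ᵥf ∂_w g`. -/
theorem integral_fderiv_mul_fderiv_comm [FiniteDimensional ℝ E] [μ.IsAddHaarMeasure]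
    {f g : E → ℝ}
    (hf : ContDiff ℝ (⊤ : ℕ∞) f) (hg : ContDiff ℝ (⊤ : ℕ∞) g) (hfs : HasCompactSupport f)
    (v w : E) :
    ∫ x, fderiv ℝ f x v * fderiv ℝ g x w ∂μ = ∫ x, fderiv ℝ f x w * fderiv ℝ g x v ∂μ := by
  have parts : ∀ a b : E, ∫ x, fderiv ℝ f x a * fderiv ℝ g x b ∂μ
      = -∫ x, fderiv ℝ (fun y => fderiv ℝ f y a) x b * g x ∂μ := by
    intro a b
    have ha := hf.fderiv_apply_const_top a
    have has : HasCompactSupport (fun x => fderiv ℝ f x a) := hfs.fderiv_apply ℝ a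
    exact integral_mul_fderiv_eq_neg_fderiv_mul_of_integrable
      ((ha.fderiv_apply_const_top b).integrable_mul_of_hasCompactSupport hg
        (has.fderiv_apply ℝ b))
      (ha.integrable_mul_of_hasCompactSupport (hg.fderiv_apply_const_top b) has)
      (ha.integrable_mul_of_hasCompactSupport hg has)
      (fun x _ => ha.differentiable (by simp) x) (fun x _ => hg.differentiable (by simp) x)
  rw [parts, parts]
  simp only [hf.fderiv_fderiv_apply_comm v w]

end IntegrationByParts

/-- Divergence control of curl-free compactly supported fields: under a Poincaré
inequality on the open set `c`, every smooth curl-free vector field with compact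
support in `c` satisfies `‖φ‖_{L²} ≤ C ‖div φ‖_{L²}`. -/
theorem curl_free_div_control
    (c : Set (EuclideanSpace ℝ (Fin 2))) (hc : IsOpen c)
    (C : ℝ) (hC : 0 < C)
    (hPoincare : ∀ ψ : EuclideanSpace ℝ (Fin 2) → ℝ,
      ContDiff ℝ (⊤ : ℕ∞) ψ → HasCompactSupport ψ → tsupport ψ ⊆ c →
      Real.sqrt (∫ x : EuclideanSpace ℝ (Fin 2), (ψ x) ^ 2)
        ≤ C * Real.sqrt (∫ x : EuclideanSpace ℝ (Fin 2),
            ((fderiv ℝ ψ x (EuclideanSpace.single 0 1)) ^ 2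
              + (fderiv ℝ ψ x (EuclideanSpace.single 1 1)) ^ 2)))
    (φ₁ φ₂ : EuclideanSpace ℝ (Fin 2) → ℝ)
    (h₁ : ContDiff ℝ (⊤ : ℕ∞) φ₁) (h₂ : ContDiff ℝ (⊤ : ℕ∞) φ₂)
    (hc₁ : HasCompactSupport φ₁) (hc₂ : HasCompactSupport φ₂)
    (hs₁ : tsupport φ₁ ⊆ c) (hs₂ : tsupport φ₂ ⊆ c)
    (hcurl : ∀ x : EuclideanSpace ℝ (Fin 2),
      fderiv ℝ φ₂ x (EuclideanSpace.single 0 1)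
        - fderiv ℝ φ₁ x (EuclideanSpace.single 1 1) = 0) :
    (∫ x : EuclideanSpace ℝ (Fin 2), ((φ₁ x) ^ 2 + (φ₂ x) ^ 2))
      ≤ C ^ 2 * ∫ x : EuclideanSpace ℝ (Fin 2),
          ((fderiv ℝ φ₁ x (EuclideanSpace.single 0 1))
            + (fderiv ℝ φ₂ x (EuclideanSpace.single 1 1))) ^ 2 := by
  have integrable_sq : ∀ f : EuclideanSpace ℝ (Fin 2) → ℝ, ContDiff ℝ (⊤ : ℕ∞) f →
      HasCompactSupport f → Integrable (fun x => f x ^ 2) := by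
    intro f hf hfs
    simpa only [sq] using hf.integrable_mul_of_hasCompactSupport hf hfs
  have integrable_grad : ∀ f : EuclideanSpace ℝ (Fin 2) → ℝ, ContDiff ℝ (⊤ : ℕ∞) f →
      HasCompactSupport f → Integrable (fun x =>
        (fderiv ℝ f x (EuclideanSpace.single 0 1)) ^ 2
          + (fderiv ℝ f x (EuclideanSpace.single 1 1)) ^ 2) := fun f hf hfs =>
    (integrable_sq _ (hf.fderiv_apply_const_top _) (hfs.fderiv_apply ℝ _)).add
      (integrable_sq _ (hf.fderiv_apply_const_top _) (hfs.fderiv_apply ℝ _))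
  have poincare_sq : ∀ f : EuclideanSpace ℝ (Fin 2) → ℝ, ContDiff ℝ (⊤ : ℕ∞) f →
      HasCompactSupport f → tsupport f ⊆ c →
      ∫ x, f x ^ 2 ≤ C ^ 2 * ∫ x, ((fderiv ℝ f x (EuclideanSpace.single 0 1)) ^ 2
          + (fderiv ℝ f x (EuclideanSpace.single 1 1)) ^ 2) := by
    intro f hf hfs hfc
    have h := pow_le_pow_left₀ (Real.sqrt_nonneg _) (hPoincare f hf hfs hfc) 2
    rwa [mul_pow, Real.sq_sqrt (integral_nonneg fun x => by positivity),
      Real.sq_sqrt (integral_nonneg fun x => by positivity)] at h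
  have hmix : ∀ v w, Integrable (fun x => fderiv ℝ φ₁ x v * fderiv ℝ φ₂ x w) := fun v w =>
    (h₁.fderiv_apply_const_top v).integrable_mul_of_hasCompactSupport
      (h₂.fderiv_apply_const_top w) (hc₁.fderiv_apply ℝ v)
  have hcross := integral_fderiv_mul_fderiv_comm (μ := volume) h₁ h₂ hc₁
    (EuclideanSpace.single 0 1) (EuclideanSpace.single 1 1)
  have hdiv : ∫ x, ((fderiv ℝ φ₁ x (EuclideanSpace.single 0 1))
        + (fderiv ℝ φ₂ x (EuclideanSpace.single 1 1))) ^ 2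
      = (∫ x, ((fderiv ℝ φ₁ x (EuclideanSpace.single 0 1)) ^ 2
          + (fderiv ℝ φ₁ x (EuclideanSpace.single 1 1)) ^ 2))
        + ∫ x, ((fderiv ℝ φ₂ x (EuclideanSpace.single 0 1)) ^ 2
          + (fderiv ℝ φ₂ x (EuclideanSpace.single 1 1)) ^ 2) := by
    have hzero : ∫ x, 2 * (fderiv ℝ φ₁ x (EuclideanSpace.single 0 1)
          * fderiv ℝ φ₂ x (EuclideanSpace.single 1 1)
        - fderiv ℝ φ₁ x (EuclideanSpace.single 1 1)
          * fderiv ℝ φ₂ x (EuclideanSpace.single 0 1)) = 0 := by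
      rw [integral_const_mul, integral_sub (hmix _ _) (hmix _ _), hcross, sub_self, mul_zero]
    have hgrad : Integrable (fun x => ((fderiv ℝ φ₁ x (EuclideanSpace.single 0 1)) ^ 2
          + (fderiv ℝ φ₁ x (EuclideanSpace.single 1 1)) ^ 2)
        + ((fderiv ℝ φ₂ x (EuclideanSpace.single 0 1)) ^ 2
          + (fderiv ℝ φ₂ x (EuclideanSpace.single 1 1)) ^ 2)) :=
      (integrable_grad φ₁ h₁ hc₁).add (integrable_grad φ₂ h₂ hc₂)
    have hdet : Integrable (fun x => 2 * (fderiv ℝ φ₁ x (EuclideanSpace.single 0 1)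
          * fderiv ℝ φ₂ x (EuclideanSpace.single 1 1)
        - fderiv ℝ φ₁ x (EuclideanSpace.single 1 1)
          * fderiv ℝ φ₂ x (EuclideanSpace.single 0 1))) :=
      ((hmix _ _).sub (hmix _ _)).const_mul 2
    rw [← integral_add (integrable_grad φ₁ h₁ hc₁) (integrable_grad φ₂ h₂ hc₂),
      ← add_zero (∫ x, (_ + _ : ℝ)), ← hzero, ← integral_add hgrad hdet]
    refine integral_congr_ae (.of_forall fun x => ?_)
    simp only [sub_eq_zero.mp (hcurl x)]
    ring
  rw [integral_add (integrable_sq φ₁ h₁ hc₁) (integrable_sq φ₂ h₂ hc₂), hdiv, mul_add]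
  exact add_le_add (poincare_sq φ₁ h₁ hc₁ hs₁) (poincare_sq φ₂ h₂ hc₂ hs₂)
end
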